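/- Let T be a face-to-face tiling of the Euclidean plane by convex polygons that is monocoronal up to congruence, in which every vertex is an extreme point of each tile containing it. Suppose there are n ≥ 1 and natural numbers a_1, …, a_n ≥ 3 such that every vertex is contained in exactly n tiles and for every vertex the multiset of numbers of extreme points of the tiles containing it equals {a_1, …, a_n}. Then ∑_{i=1}^{n} 1/a_i = n/2 − 1 (as real numbers). -/

import Mathlib

noncomputable section

open Set

abbrev E2 := EuclideanSpace ℝ (Fin 2)

/-- A convex polygon: a compact convex subset of the plane with nonempty interior
and finitely many extreme points. -/
def IsConvexPolygon (P : Set E2) : Prop :=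
  IsCompact P ∧ Convex ℝ P ∧ (interior P).Nonempty ∧ (Set.extremePoints ℝ P).Finite

/-- A tiling of the plane by convex polygons. -/
def IsTiling (T : Set (Set E2)) : Prop :=
  T.Countable ∧ (∀ P ∈ T, IsConvexPolygon P) ∧ (⋃₀ T = Set.univ) ∧
    T.Pairwise fun P Q => Disjoint (interior P) (interior Q)

/-- A vertex of a tiling: an extreme point of at least one tile. -/
def IsVertex (T : Set (Set E2)) (x : E2) : Prop :=
  ∃ P ∈ T, x ∈ Set.extremePoints ℝ P

/-- An isometry of the plane is orientation preserving if its linear part has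
determinant `1`. -/
def OrientationPreserving (f : E2 ≃ᵃⁱ[ℝ] E2) : Prop :=
  LinearMap.det (f.linearIsometryEquiv.toLinearEquiv : E2 →ₗ[ℝ] E2) = 1

/-- Monocoronal up to rigid motions: any two vertex coronae are directly congruent. -/
def MonocoronalRM (T : Set (Set E2)) : Prop :=
  ∀ x y : E2, IsVertex T x → IsVertex T y →
    ∃ f : E2 ≃ᵃⁱ[ℝ] E2, OrientationPreserving f ∧ f x = y ∧
      (fun P => f '' P) '' {P | P ∈ T ∧ x ∈ P} = {P | P ∈ T ∧ y ∈ P}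

/-- Monocoronal up to congruence: any two vertex coronae are congruent
(mirror images allowed). -/
def MonocoronalC (T : Set (Set E2)) : Prop :=
  ∀ x y : E2, IsVertex T x → IsVertex T y →
    ∃ f : E2 ≃ᵃⁱ[ℝ] E2, f x = y ∧
      (fun P => f '' P) '' {P | P ∈ T ∧ x ∈ P} = {P | P ∈ T ∧ y ∈ P}

/-- A symmetry of a tiling: an isometry mapping the set of tiles onto itself. -/
def IsSymmetry (T : Set (Set E2)) (f : E2 ≃ᵃⁱ[ℝ] E2) : Prop :=
  (fun P => f '' P) '' T = T

/-- The set of translation vectors of a tiling. -/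
def periodVectors (T : Set (Set E2)) : Set E2 :=
  {v | IsSymmetry T (AffineIsometryEquiv.constVAdd ℝ E2 v)}

/-- A tiling is face-to-face if the intersection of any two distinct tiles is an
extreme subset of each of them. -/
def FaceToFace (T : Set (Set E2)) : Prop :=
  ∀ P ∈ T, ∀ Q ∈ T, P ≠ Q → IsExtreme ℝ P (P ∩ Q) ∧ IsExtreme ℝ Q (P ∩ Q)


open MeasureTheory

def crs (a b : E2) : ℝ := a 0 * b 1 - a 1 * b 0
def dt (a b : E2) : ℝ := a 0 * b 0 + a 1 * b 1

lemma dt_cont (a : E2) : Continuous (dt a) := by unfold dt; fun_prop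
lemma crs_cont (a : E2) : Continuous (crs a) := by unfold crs; fun_prop
lemma crs_cont' (a : E2) : Continuous (fun u => crs u a) := by unfold crs; fun_prop

lemma ext2 {a b : E2} (h0 : a 0 = b 0) (h1 : a 1 = b 1) : a = b := by
  ext i; fin_cases i <;> simpa

lemma ne_zero_coord {b : E2} (hb : b ≠ 0) : 0 < b 0 ^ 2 + b 1 ^ 2 := by
  by_contra h
  apply hb
  apply ext2 <;> simp <;> nlinarith [sq_nonneg (b 0), sq_nonneg (b 1)]

def dtL (b : E2) : E2 →ₗ[ℝ] ℝ where
  toFun := dt b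
  map_add' x y := by simp [dt]; ring
  map_smul' x y := by simp [dt]; ring

lemma null_line {b : E2} (hb : b ≠ 0) : volume {u | dt b u = 0} = 0 := by
  have : {u | dt b u = 0} = (LinearMap.ker (dtL b) : Set E2) := by
    ext u; simp [dtL]
  rw [this]
  apply Measure.addHaar_submodule
  intro h
  have h2 : b ∈ LinearMap.ker (dtL b) := by rw [h]; trivial
  have h3 := ne_zero_coord hb
  simp [dtL, dt] at h2
  nlinarith

/-- normalized measure -/
def nm (S : Set E2) : ℝ := volume.real (S ∩ Metric.ball 0 1)

lemma nm_union {A B : Set E2} (hB : MeasurableSet B) {b : E2} (hb : b ≠ 0)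
    (h : A ∩ B ⊆ {u | dt b u = 0}) : nm (A ∪ B) = nm A + nm B := by
  unfold nm
  rw [Set.union_inter_distrib_right]
  have := measureReal_union_add_inter (μ := (volume : Measure E2)) (s := A ∩ Metric.ball 0 1)
    (t := B ∩ Metric.ball 0 1) (hB.inter measurableSet_ball)
    (ne_top_of_le_ne_top measure_ball_lt_top.ne (measure_mono inter_subset_right))
    (ne_top_of_le_ne_top measure_ball_lt_top.ne (measure_mono inter_subset_right))
  have h0 : volume.real ((A ∩ Metric.ball 0 1) ∩ (B ∩ Metric.ball (0:E2) 1)) = 0 := by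
    rw [measureReal_def, measure_mono_null _ (null_line hb)]; rfl
    intro u hu; exact h ⟨hu.1.1, hu.2.1⟩
  linarith

/-- finite almost disjoint cover -/
lemma nm_sum {ι : Type*} (s : Finset ι) (A : ι → Set E2) (hm : ∀ i ∈ s, MeasurableSet (A i))
    (hd : ∀ i ∈ s, ∀ j ∈ s, i ≠ j → ∃ b : E2, b ≠ 0 ∧ A i ∩ A j ⊆ {u | dt b u = 0})
    (hc : ∀ u, ∃ i ∈ s, u ∈ A i) : ∑ i ∈ s, nm (A i) = nm univ := by
  have : (univ : Set E2) = ⋃ i ∈ s, A i := by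
    ext u; simpa using hc u
  rw [this]
  unfold nm
  rw [Set.iUnion₂_inter]
  rw [measureReal_biUnion_finset₀]
  · intro i hi j hj hij
    obtain ⟨b, hb, h⟩ := hd i hi j hj hij
    refine measure_mono_null ?_ (null_line hb)
    intro u hu; exact h ⟨hu.1.1, hu.2.1⟩
  · intro i hi; exact ((hm i hi).inter measurableSet_ball).nullMeasurableSet

lemma nm_univ_pos : 0 < nm univ := by
  unfold nm
  rw [univ_inter, measureReal_def]
  exact ENNReal.toReal_pos (Metric.measure_ball_pos _ _ one_pos).ne' measure_ball_lt_top.ne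

lemma nm_nonneg (A : Set E2) : 0 ≤ nm A := measureReal_nonneg

lemma nm_le (A : Set E2) : nm A ≤ nm univ := by
  unfold nm
  exact measureReal_mono (by simp) (by rw [univ_inter]; exact measure_ball_lt_top.ne)

lemma nm_iso (L : E2 ≃ₗᵢ[ℝ] E2) (A : Set E2) : nm (L ⁻¹' A) = nm A := by
  unfold nm
  have h : L ⁻¹' A ∩ Metric.ball 0 1 = L ⁻¹' (A ∩ Metric.ball 0 1) := by
    ext u; simp
  rw [h, measureReal_def, measureReal_def]
  congr 1
  exact L.measurePreserving.measure_preimage_emb L.toHomeomorph.measurableEmbedding _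

def Kr : E2 ≃ₗᵢ[ℝ] E2 where
  toFun u := !₂[u 1, - u 0]
  invFun u := !₂[- u 1, u 0]
  map_add' x y := by apply ext2 <;> simp; ring
  map_smul' x y := by apply ext2 <;> simp
  left_inv x := by apply ext2 <;> simp
  right_inv x := by apply ext2 <;> simp
  norm_map' x := by
    simp [EuclideanSpace.norm_eq, Fin.sum_univ_two, add_comm]

lemma nm_half {q : E2} (hq : q ≠ 0) : nm {u | dt q u ≤ 0} = nm univ / 2 := by
  have h1 := nm_union (A := {u | dt q u ≤ 0}) (B := {u | 0 ≤ dt q u})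
    (measurableSet_le measurable_const (dt_cont q).measurable) hq
    (by intro u hu; exact le_antisymm hu.1 hu.2)
  have h2 : {u | dt q u ≤ 0} ∪ {u | 0 ≤ dt q u} = univ := by
    ext u; simp [le_total]
  have h3 : nm {u | 0 ≤ dt q u} = nm {u | dt q u ≤ 0} := by
    rw [← nm_iso (LinearIsometryEquiv.neg ℝ) {u | dt q u ≤ 0}]
    congr 1
    ext u; simp [dt]; constructor <;> intro <;> linarith
  rw [h2, h3] at h1
  linarith

lemma nm_cone {p q : E2} (h : 0 < crs p q) :
    nm {u | 0 ≤ crs p u ∧ 0 ≤ crs u q} + nm {u | dt p u ≤ 0 ∧ dt q u ≤ 0} = nm univ / 2 := by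
  have hp : p ≠ 0 := by rintro rfl; simp [crs] at h
  have hq : q ≠ 0 := by rintro rfl; simp [crs] at h
  have h1 : {u | 0 ≤ crs p u ∧ 0 ≤ crs u q} = Kr ⁻¹' {u | 0 ≤ dt p u ∧ dt q u ≤ 0} := by
    ext u
    have e1 : (Kr u) 0 = u 1 := by simp [Kr]
    have e2 : (Kr u) 1 = - u 0 := by simp [Kr]
    simp only [mem_ofPred_eq, mem_preimage, crs, dt, e1, e2]
    constructor <;> rintro ⟨h, h'⟩ <;> constructor <;> linarith
  rw [h1, nm_iso, ← nm_half hq, ← nm_union (b := p) _ hp]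
  · congr 1
    ext u
    simp only [mem_union, mem_ofPred_eq]
    have := le_total 0 (dt p u)
    tauto
  · intro u hu; exact le_antisymm hu.2.1 hu.1.1
  · exact (measurableSet_le (dt_cont p).measurable measurable_const).inter
      (measurableSet_le (dt_cont q).measurable measurable_const)

lemma poly_hull {P : Set E2} (h : IsConvexPolygon P) : convexHull ℝ (extremePoints ℝ P) = P := by
  obtain ⟨h1, h2, h3, h4⟩ := h
  rw [← (h4.isClosed_convexHull ℝ).closure_eq]
  exact closure_convexHull_extremePoints h1 h2

/-- tangent cone and normal cone -/
def Cn (P : Set E2) (x : E2) : Set E2 := {u | ∃ t : ℝ, 0 < t ∧ x + t • u ∈ P}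
def Nr (P : Set E2) (x : E2) : Set E2 := {u | ∀ y ∈ P, dt u (y - x) ≤ 0}

lemma convex_crs (p x : E2) : Convex ℝ {y | 0 ≤ crs p (y - x)} := by
  intro y hy z hz a b ha hb hab
  simp only [mem_ofPred_eq, crs, PiLp.sub_apply, PiLp.add_apply, PiLp.smul_apply, smul_eq_mul] at *
  obtain rfl : a = 1 - b := by linarith
  nlinarith [mul_nonneg ha hy, mul_nonneg hb hz]

lemma convex_crs' (p x : E2) : Convex ℝ {y | 0 ≤ crs (y - x) p} := by
  have : {y | 0 ≤ crs (y - x) p} = {y | 0 ≤ crs (-p) (y - x)} := by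
    ext y; simp only [mem_ofPred_eq, crs, PiLp.neg_apply]; constructor <;> intro <;> linarith
  rw [this]; exact convex_crs _ _

lemma convex_dt (p x : E2) : Convex ℝ {y | dt p (y - x) ≤ 0} := by
  intro y hy z hz a b ha hb hab
  simp only [mem_ofPred_eq, dt, PiLp.sub_apply, PiLp.add_apply, PiLp.smul_apply, smul_eq_mul] at *
  obtain rfl : a = 1 - b := by linarith
  nlinarith [mul_nonneg ha (neg_nonneg.2 hy), mul_nonneg hb (neg_nonneg.2 hz)]

/-- a functional is a dot product -/
lemma clm_dt (f : E2 →L[ℝ] ℝ) : ∃ b : E2, ∀ u, f u = dt b u := by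
  refine ⟨!₂[f !₂[1,0], f !₂[0,1]], fun u => ?_⟩
  have : u = u 0 • !₂[1,0] + u 1 • !₂[0,1] := by apply ext2 <;> simp
  conv_lhs => rw [this]
  simp [dt, mul_comm]

lemma poly_gens {P : Set E2} (h : IsConvexPolygon P) {x : E2} (hx : x ∈ extremePoints ℝ P) :
    ∃ p q : E2, 0 < crs p q ∧ x + p ∈ P ∧ x + q ∈ P ∧
      ∀ y ∈ P, 0 ≤ crs p (y - x) ∧ 0 ≤ crs (y - x) q := by
  have hh := poly_hull h
  obtain ⟨h1, h2, h3, h4⟩ := h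
  set V := extremePoints ℝ P \ {x} with hV
  have hVf : V.Finite := h4.sdiff
  have hVP : V ⊆ P := fun v hv => extremePoints_subset hv.1
  -- no line contains P
  have hline : ∀ b : E2, b ≠ 0 → ¬ ∀ v ∈ V, crs b (v - x) = 0 := by
    intro b hb hv
    have hPl : ∀ y ∈ P, crs b (y - x) = 0 := by
      have hs : P ⊆ {y | 0 ≤ crs b (y - x)} ∩ {y | 0 ≤ crs (y - x) b} := by
        rw [← hh]
        apply convexHull_min _ ((convex_crs b x).inter (convex_crs' b x))
        intro y hy
        have : crs b (y - x) = 0 := by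
          by_cases hyx : y = x
          · simp [hyx, crs]
          · exact hv y ⟨hy, hyx⟩
        constructor
        · exact this.ge
        · simp only [mem_ofPred_eq, crs] at *; linarith
      intro y hy
      have := hs hy
      simp only [mem_inter_iff, mem_ofPred_eq, crs] at *
      linarith
    obtain ⟨z, hz⟩ := h3
    set c : E2 := !₂[-b 1, b 0] with hc
    have hcont : Continuous (fun t : ℝ => z + t • c) := by fun_prop
    have hmem : ∀ᶠ t in nhds (0:ℝ), z + t • c ∈ P := by
      have : ∀ᶠ t in nhds (0:ℝ), z + t • c ∈ interior P :=
        hcont.continuousAt.eventually (by simpa using isOpen_interior.mem_nhds hz)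
      exact this.mono fun t ht => interior_subset ht
    have hm2 : ∀ᶠ t in nhdsWithin (0:ℝ) {0}ᶜ, z + t • c ∈ P := hmem.filter_mono nhdsWithin_le_nhds
    obtain ⟨t, ht, ht0⟩ := (hm2.and self_mem_nhdsWithin).exists
    have e1 := hPl _ ht
    have e2 := hPl _ (interior_subset hz)
    have e3 := ne_zero_coord hb
    simp [crs, hc] at e1 e2
    have : t * (b 0 ^ 2 + b 1 ^ 2) = 0 := by linarith
    rcases mul_eq_zero.1 this with h | h
    · exact ht0 h
    · linarith
  have hVne : V.Nonempty := by
    by_contra hne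
    rw [not_nonempty_iff_eq_empty] at hne
    apply hline !₂[1,0]
    · intro h; have := congrArg (fun v : E2 => v 0) h; simp at this
    · simp [hne]
  have hxV : x ∉ convexHull ℝ V := by
    have := (h2.mem_extremePoints_iff_mem_sdiff_convexHull_sdiff).1 hx
    intro hc
    apply this.2
    refine convexHull_mono ?_ hc
    intro v hv; exact ⟨hVP hv, hv.2⟩
  obtain ⟨f, s, hfs, hsf⟩ := geometric_hahn_banach_point_closed (convex_convexHull ℝ V)
    (hVf.isClosed_convexHull ℝ) hxV
  obtain ⟨b, hb⟩ := clm_dt f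
  have hpos : ∀ v ∈ V, 0 < dt b (v - x) := by
    intro v hv
    rw [← hb, map_sub]
    have := hsf v (subset_convexHull ℝ V hv)
    linarith
  have hb0 : b ≠ 0 := by
    rintro rfl
    obtain ⟨v, hv⟩ := hVne
    have := hpos v hv
    simp [dt] at this
  have hbp := ne_zero_coord hb0
  have hid : ∀ p v : E2, dt b p * crs b v - dt b v * crs b p = (b 0 ^ 2 + b 1 ^ 2) * crs p v := by
    intro p v; simp only [dt, crs]; ring
  obtain ⟨v1, hv1, hmin⟩ := Set.exists_min_image V (fun v => crs b (v - x) / dt b (v - x)) hVf hVne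
  obtain ⟨v2, hv2, hmax⟩ := Set.exists_max_image V (fun v => crs b (v - x) / dt b (v - x)) hVf hVne
  have k1 : ∀ v ∈ V, 0 ≤ crs (v1 - x) (v - x) := by
    intro v hv
    have := hmin v hv
    rw [div_le_div_iff₀ (hpos _ hv1) (hpos _ hv)] at this
    have h' := hid (v1 - x) (v - x)
    by_contra hneg
    push Not at hneg
    nlinarith
  have k2 : ∀ v ∈ V, 0 ≤ crs (v - x) (v2 - x) := by
    intro v hv
    have := hmax v hv
    rw [div_le_div_iff₀ (hpos _ hv) (hpos _ hv2)] at this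
    have h' := hid (v - x) (v2 - x)
    by_contra hneg
    push Not at hneg
    nlinarith
  refine ⟨v1 - x, v2 - x, ?_, by simpa using hVP hv1, by simpa using hVP hv2, ?_⟩
  · refine lt_of_le_of_ne (k1 _ hv2) fun h0 => ?_
    apply hline (v1 - x)
    · intro h; have := hpos _ hv1; rw [h] at this; simp [dt] at this
    · intro v hv
      refine le_antisymm ?_ (k1 v hv)
      have hh1 := k2 v hv
      have p1 := hpos _ hv1
      have p2 := hpos _ hv2
      -- dt b q * crs v p = dt b p * crs v q + dt b v * crs q p
      have key : dt b (v2 - x) * crs (v - x) (v1 - x) = dt b (v1 - x) * crs (v - x) (v2 - x)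
          - dt b (v - x) * crs (v1 - x) (v2 - x) := by
        simp only [dt, crs]; ring
      have hs : crs (v - x) (v1 - x) = - crs (v1 - x) (v - x) := by simp only [crs]; ring
      rw [← h0, hs] at key
      by_contra hneg
      push Not at hneg
      nlinarith [mul_nonneg p1.le hh1, mul_pos p2 hneg]
  · have hs : P ⊆ {y | 0 ≤ crs (v1 - x) (y - x)} ∩ {y | 0 ≤ crs (y - x) (v2 - x)} := by
      conv_lhs => rw [← hh]
      apply convexHull_min _ ((convex_crs _ x).inter (convex_crs' _ x))
      intro y hy
      by_cases hyx : y = x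
      · simp [hyx, crs]
      · exact ⟨k1 y ⟨hy, hyx⟩, k2 y ⟨hy, hyx⟩⟩
    exact fun y hy => hs hy

lemma dt_comm (a b : E2) : dt a b = dt b a := by simp only [dt]; ring

lemma poly_cones {P : Set E2} (h : IsConvexPolygon P) {x : E2} (hx : x ∈ extremePoints ℝ P) :
    MeasurableSet (Cn P x) ∧ nm (Cn P x) + nm (Nr P x) = nm univ / 2 := by
  obtain ⟨p, q, hpq, hp, hq, hall⟩ := poly_gens h hx
  have hxP := extremePoints_subset hx
  have hdec : ∀ u : E2, u = (crs u q / crs p q) • p + (crs p u / crs p q) • q := by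
    intro u
    have := hpq.ne'
    apply ext2 <;> simp <;> field_simp <;> simp only [crs] <;> ring
  have hC : Cn P x = {u | 0 ≤ crs p u ∧ 0 ≤ crs u q} := by
    ext u
    constructor
    · rintro ⟨t, ht, hy⟩
      have := hall _ hy
      simp only [add_sub_cancel_left] at this
      have e1 : crs p (t • u) = t * crs p u := by simp [crs]; ring
      have e2 : crs (t • u) q = t * crs u q := by simp [crs]; ring
      rw [e1, e2] at this
      exact ⟨nonneg_of_mul_nonneg_right this.1 ht, nonneg_of_mul_nonneg_right this.2 ht⟩
    · rintro ⟨h1, h2⟩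
      set α := crs u q / crs p q with hα
      set β := crs p u / crs p q with hβ
      have ha : 0 ≤ α := div_nonneg h2 hpq.le
      have hb : 0 ≤ β := div_nonneg h1 hpq.le
      have hs : 0 < 1 + α + β := by linarith
      refine ⟨(1 + α + β)⁻¹, inv_pos.2 hs, ?_⟩
      have hcv := h.2.1
      have m := hcv.sum_mem (t := Finset.univ) (w := ![(1 + α + β)⁻¹, (1 + α + β)⁻¹ * α, (1 + α + β)⁻¹ * β])
        (z := ![x, x + p, x + q]) (by
          intro i _; fin_cases i <;> simp <;> positivity) (by
          simp [Fin.sum_univ_three]; field_simp) (by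
          intro i _; fin_cases i <;> simpa)
      convert m using 1
      rw [hdec u]
      simp only [Fin.sum_univ_three, Matrix.cons_val]
      rw [← hα, ← hβ]
      apply ext2 <;> simp <;> field_simp <;> ring
  have hN : Nr P x = {u | dt p u ≤ 0 ∧ dt q u ≤ 0} := by
    ext u
    constructor
    · intro hu
      have e1 := hu _ hp
      have e2 := hu _ hq
      rw [add_sub_cancel_left, dt_comm] at e1 e2
      exact ⟨e1, e2⟩
    · rintro ⟨h1, h2⟩ y hy
      obtain ⟨g1, g2⟩ := hall y hy
      rw [hdec (y - x)]
      have ha : 0 ≤ crs (y - x) q / crs p q := div_nonneg g2 hpq.le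
      have hb : 0 ≤ crs p (y - x) / crs p q := div_nonneg g1 hpq.le
      generalize crs (y - x) q / crs p q = α at *
      generalize crs p (y - x) / crs p q = β at *
      have : dt u (α • p + β • q) = α * dt p u + β * dt q u := by simp [dt]; ring
      rw [this]
      nlinarith [mul_nonneg ha (neg_nonneg.2 h1), mul_nonneg hb (neg_nonneg.2 h2)]
  rw [hC, hN]
  exact ⟨(measurableSet_le measurable_const (crs_cont p).measurable).inter
      (measurableSet_le measurable_const (crs_cont' q).measurable), nm_cone hpq⟩

lemma Nr_closed (P : Set E2) (x : E2) : IsClosed (Nr P x) := by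
  have : Nr P x = ⋂ y ∈ P, {u | dt (y - x) u ≤ 0} := by
    ext u; simp [Nr, dt_comm u]
  rw [this]
  exact isClosed_biInter fun y _ => isClosed_le (dt_cont _) continuous_const

lemma poly_ext_sum {P : Set E2} (h : IsConvexPolygon P) :
    ∑ x ∈ h.2.2.2.toFinset, nm (Nr P x) = nm univ := by
  have hh := poly_hull h
  have hne : (extremePoints ℝ P).Nonempty := by
    obtain ⟨z, hz⟩ := h.2.2.1
    exact h.1.extremePoints_nonempty ⟨z, interior_subset hz⟩
  apply nm_sum
  · intro i _; exact (Nr_closed P i).measurableSet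
  · intro x hx y hy hxy
    simp only [Finite.mem_toFinset] at hx hy
    refine ⟨x - y, sub_ne_zero.2 hxy, ?_⟩
    rintro u ⟨h1, h2⟩
    have e1 := h1 y (extremePoints_subset hy)
    have e2 := h2 x (extremePoints_subset hx)
    simp only [dt, mem_ofPred_eq, PiLp.sub_apply] at *
    linarith
  · intro u
    obtain ⟨v, hv, hmax⟩ := Set.exists_max_image _ (fun v => dt u v) h.2.2.2 hne
    refine ⟨v, by simpa using hv, ?_⟩
    have : P ⊆ {y | dt u (y - v) ≤ 0} := by
      conv_lhs => rw [← hh]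
      apply convexHull_min _ (convex_dt _ _)
      intro y hy
      have := hmax y hy
      simp only [dt, mem_ofPred_eq, PiLp.sub_apply] at *
      linarith
    exact this

lemma cones_disj {P Q : Set E2} (hP : IsConvexPolygon P) (hQ : IsConvexPolygon Q)
    (hd : Disjoint (interior P) (interior Q)) {x : E2} (hxP : x ∈ P) (hxQ : x ∈ Q) :
    ∃ b : E2, b ≠ 0 ∧ Cn P x ∩ Cn Q x ⊆ {u | dt b u = 0} := by
  obtain ⟨f, s, h1, h2⟩ := geometric_hahn_banach_open hP.2.1.interior isOpen_interior
    hQ.2.1.interior hd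
  have cP : P ⊆ {a | f a ≤ s} := by
    have : P = closure (interior P) := by
      rw [hP.2.1.closure_interior_eq_closure_of_nonempty_interior hP.2.2.1, hP.1.isClosed.closure_eq]
    rw [this]
    exact closure_minimal (fun a ha => (h1 a ha).le) (isClosed_le f.continuous continuous_const)
  have cQ : Q ⊆ {a | s ≤ f a} := by
    have : Q = closure (interior Q) := by
      rw [hQ.2.1.closure_interior_eq_closure_of_nonempty_interior hQ.2.2.1, hQ.1.isClosed.closure_eq]
    rw [this]
    exact closure_minimal (fun a ha => h2 a ha) (isClosed_le continuous_const f.continuous)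
  have hfx : f x = s := le_antisymm (cP hxP) (cQ hxQ)
  obtain ⟨b, hb⟩ := clm_dt f
  refine ⟨b, ?_, ?_⟩
  · rintro rfl
    obtain ⟨z, hz⟩ := hP.2.2.1
    obtain ⟨w, hw⟩ := hQ.2.2.1
    have e1 := h1 z hz
    have e2 := h2 w hw
    simp only [hb] at e1 e2
    simp [dt] at e1 e2
    linarith
  · rintro u ⟨⟨t, ht, hu⟩, ⟨r, hr, hu'⟩⟩
    have e1 := cP hu
    have e2 := cQ hu'
    simp only [mem_ofPred_eq, map_add, map_smul, hfx, smul_eq_mul] at e1 e2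
    simp only [mem_ofPred_eq]
    rw [← hb]
    nlinarith

/-- local finiteness at x yields the full angle -/
lemma full_angle {T : Set (Set E2)} (hT : IsTiling T) {x : E2}
    (hloc : {P | P ∈ T ∧ (P ∩ Metric.ball x 1).Nonempty}.Finite)
    (hext : ∀ P ∈ T, x ∈ P → x ∈ extremePoints ℝ P)
    (s : Finset (Set E2)) (hs : ∀ P, P ∈ s ↔ P ∈ T ∧ x ∈ P) :
    ∑ P ∈ s, nm (Cn P x) = nm univ := by
  obtain ⟨_, hpol, hcov, hdis⟩ := hT
  apply nm_sum
  · intro P hP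
    obtain ⟨h1, h2⟩ := (hs P).1 hP
    exact (poly_cones (hpol P h1) (hext P h1 h2)).1
  · intro P hP Q hQ hPQ
    obtain ⟨h1, h2⟩ := (hs P).1 hP
    obtain ⟨h3, h4⟩ := (hs Q).1 hQ
    exact cones_disj (hpol P h1) (hpol Q h3) (hdis h1 h3 hPQ) h2 h4
  · intro u
    have hc : Continuous (fun t : ℝ => x + t • u) := by fun_prop
    have hlim : Filter.Tendsto (fun t : ℝ => x + t • u) (nhdsWithin 0 (Ioi 0)) (nhds x) := by
      have := (hc.tendsto 0).mono_left (nhdsWithin_le_nhds (s := Ioi 0))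
      simpa using this
    have hball : ∀ᶠ t in nhdsWithin (0:ℝ) (Ioi 0), x + t • u ∈ Metric.ball x 1 :=
      hlim.eventually (Metric.ball_mem_nhds x one_pos)
    have hex : ∀ᶠ t in nhdsWithin (0:ℝ) (Ioi 0),
        ∃ P ∈ {P | P ∈ T ∧ (P ∩ Metric.ball x 1).Nonempty}, x + t • u ∈ P := by
      filter_upwards [hball] with t ht
      have : x + t • u ∈ ⋃₀ T := by rw [hcov]; trivial
      obtain ⟨P, hP, hm⟩ := this
      exact ⟨P, ⟨hP, ⟨_, hm, ht⟩⟩, hm⟩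
    have hfr : ∃ P ∈ {P | P ∈ T ∧ (P ∩ Metric.ball x 1).Nonempty},
        ∃ᶠ t in nhdsWithin (0:ℝ) (Ioi 0), x + t • u ∈ P := by
      by_contra hcon
      push Not at hcon
      have := (Filter.eventually_all_finite hloc).2 hcon
      obtain ⟨t, ⟨P, hP, hm⟩, ht⟩ := (hex.and this).exists
      exact ht P hP hm
    obtain ⟨P, hP, hf⟩ := hfr
    have hxP : x ∈ P := by
      have hcl := (hpol P hP.1).1.isClosed
      exact hcl.mem_of_frequently_of_tendsto hf hlim
    obtain ⟨t, ht, ht0⟩ := (hf.and_eventually self_mem_nhdsWithin).exists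
    exact ⟨P, (hs P).2 ⟨hP.1, hxP⟩, t, ht0, ht⟩

lemma growth {X Y : Type*} [DecidableEq X] (S : ℕ → Finset X) (hmono : ∀ k, S k ⊆ S (k+1))
    (N : X → Finset Y) (M : Y → Finset X) (f : Y → X → ℝ) (n : ℕ) (c B C : ℝ) (hB : 0 < B)
    (hcard : ∀ k, ∀ x ∈ S k, (N x).card ≤ n) (hn : 1 ≤ n)
    (hinc : ∀ k, ∀ x ∈ S k, ∀ P ∈ N x, ∀ y, y ∈ M P → P ∈ N y)
    (hinc' : ∀ k, ∀ x ∈ S k, ∀ P ∈ N x, ∀ y, P ∈ N y → y ∈ M P)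
    (hf : ∀ k, ∀ x ∈ S k, ∀ P ∈ N x, |f P x| ≤ B)
    (hf0 : ∀ k, ∀ x ∈ S k, ∀ P ∈ N x, ∑ y ∈ M P, f P y = 0)
    (hc : ∀ k, ∀ x ∈ S k, ∑ P ∈ N x, f P x = c)
    (hstep : ∀ k, ∀ x ∈ S k, ∀ P ∈ N x, M P ⊆ S (k+1))
    (h0 : (S 0).Nonempty) (hgr : ∀ k, ((S k).card : ℝ) ≤ C * ((k:ℝ) + 1)^2) : c = 0 := by
  classical
  by_contra hc0
  have hn' : (0:ℝ) < n := by exact_mod_cast hn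
  have key : ∀ k, |c| * ((S (k+1)).card : ℝ) ≤ n * B * ((S (k+1)).card - (S k).card) := by
    intro k
    have e1 : c * ((S (k+1)).card : ℝ) = ∑ x ∈ S (k+1), ∑ P ∈ N x, f P x := by
      rw [Finset.sum_congr rfl (hc (k+1))]; simp [mul_comm]
    have e2 : ∑ x ∈ S (k+1), ∑ P ∈ N x, f P x =
        ∑ x ∈ S (k+1), ∑ P ∈ (N x).filter (fun P => M P ⊆ S (k+1)), f P x
        + ∑ x ∈ S (k+1), ∑ P ∈ (N x).filter (fun P => ¬ M P ⊆ S (k+1)), f P x := by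
      rw [← Finset.sum_add_distrib]
      exact Finset.sum_congr rfl fun x _ => (Finset.sum_filter_add_sum_filter_not _ _ _).symm
    have e3 : ∑ x ∈ S (k+1), ∑ P ∈ (N x).filter (fun P => M P ⊆ S (k+1)), f P x = 0 := by
      rw [Finset.sum_comm' (t' := ((S (k+1)).biUnion N).filter (fun P => M P ⊆ S (k+1))) (s' := M)]
      · apply Finset.sum_eq_zero
        intro P hP
        simp only [Finset.mem_filter, Finset.mem_biUnion] at hP
        obtain ⟨⟨x, hx, hxP⟩, _⟩ := hP
        exact hf0 _ x hx P hxP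
      · intro x P
        simp only [Finset.mem_filter, Finset.mem_biUnion]
        constructor
        · rintro ⟨h1, h2, h3⟩
          exact ⟨hinc' _ x h1 P h2 x h2, ⟨x, h1, h2⟩, h3⟩
        · rintro ⟨h1, ⟨y, hy, hyP⟩, h3⟩
          exact ⟨h3 h1, hinc _ y hy P hyP x h1, h3⟩
    have e4 : ∑ x ∈ S (k+1), ∑ P ∈ (N x).filter (fun P => ¬ M P ⊆ S (k+1)), f P x =
        ∑ x ∈ S (k+1) \ S k, ∑ P ∈ (N x).filter (fun P => ¬ M P ⊆ S (k+1)), f P x := by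
      symm
      apply Finset.sum_subset Finset.sdiff_subset
      intro x hx hx'
      have hxk : x ∈ S k := by
        by_contra h; exact hx' (Finset.mem_sdiff.2 ⟨hx, h⟩)
      apply Finset.sum_eq_zero
      intro P hP
      simp only [Finset.mem_filter] at hP
      exact absurd (hstep k x hxk P hP.1) hP.2
    have e5 : |∑ x ∈ S (k+1) \ S k, ∑ P ∈ (N x).filter (fun P => ¬ M P ⊆ S (k+1)), f P x|
        ≤ ∑ x ∈ S (k+1) \ S k, (n * B : ℝ) := by
      refine (Finset.abs_sum_le_sum_abs _ _).trans (Finset.sum_le_sum fun x hx => ?_)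
      have hx' := (Finset.mem_sdiff.1 hx).1
      refine (Finset.abs_sum_le_sum_abs _ _).trans ?_
      refine (Finset.sum_le_sum (g := fun _ => B) fun P hP => hf _ x hx' P (Finset.mem_filter.1 hP).1).trans ?_
      rw [Finset.sum_const, nsmul_eq_mul]
      have : (((N x).filter (fun P => ¬ M P ⊆ S (k+1))).card : ℝ) ≤ n := by
        exact_mod_cast (Finset.card_filter_le _ _).trans (hcard _ x hx')
      exact mul_le_mul_of_nonneg_right this hB.le
    rw [Finset.sum_const, nsmul_eq_mul, Finset.card_sdiff_of_subset (hmono k),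
      Nat.cast_sub (Finset.card_le_card (hmono k))] at e5
    have : |c| * ((S (k+1)).card : ℝ) = |c * ((S (k+1)).card : ℝ)| := by
      rw [abs_mul, Nat.abs_cast]
    rw [this, e1, e2, e3, zero_add, e4]
    linarith
  have hcp : 0 < |c| := abs_pos.2 hc0
  set q : ℝ := 1 + |c| / (n * B) with hq
  have hq1 : 1 < q := by rw [hq]; have : 0 < |c| / (n * B) := by positivity
                         linarith
  have hexp : ∀ k, q ^ k ≤ ((S k).card : ℝ) := by
    intro k
    induction k with
    | zero => simpa using h0
    | succ k ih =>
      have h1 := key k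
      have h2 : ((S k).card : ℝ) ≤ (S (k+1)).card := by exact_mod_cast Finset.card_le_card (hmono k)
      have h3 : |c| * ((S k).card : ℝ) ≤ n * B * ((S (k+1)).card - (S k).card) :=
        (mul_le_mul_of_nonneg_left h2 hcp.le).trans h1
      have h4 : |c| / (n * B) * ((S k).card : ℝ) ≤ ((S (k+1)).card - (S k).card) := by
        rw [div_mul_eq_mul_div, div_le_iff₀ (by positivity)]; linarith
      rw [pow_succ]
      have h5 : q ^ k * q ≤ (S k).card * q := mul_le_mul_of_nonneg_right ih (by linarith)
      rw [hq] at h5 ⊢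
      nlinarith
  have hlim := tendsto_pow_const_div_const_pow_of_one_lt 2 hq1
  have hlim2 := ((Filter.tendsto_add_atTop_iff_nat 1).2 hlim).const_mul (C * q)
  rw [mul_zero] at hlim2
  obtain ⟨k, hk⟩ := (hlim2.eventually (gt_mem_nhds (zero_lt_one))).exists
  have hqk : 0 < q ^ k := by positivity
  have := (hexp k).trans (hgr k)
  have h6 : C * q * (((k + 1 : ℕ) : ℝ) ^ 2 / q ^ (k+1)) = C * ((k:ℝ)+1)^2 / q ^ k := by
    push_cast; field_simp; ring
  rw [h6, div_lt_one hqk] at hk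
  linarith

section counting

lemma tiles_count {T : Set (Set E2)} (hT : IsTiling T) {D r : ℝ} (hD : 0 < D) (hr : 0 < r)
    (hdiam : ∀ P ∈ T, ∀ y ∈ P, ∀ z ∈ P, dist y z ≤ D)
    (hball : ∀ P ∈ T, ∃ w, Metric.ball w r ⊆ P) {R : ℝ} (hR : 0 ≤ R)
    (G : Finset (Set E2)) (hG : ∀ P ∈ G, P ∈ T ∧ (P ∩ Metric.ball 0 R).Nonempty) :
    (G.card : ℝ) ≤ (R + D) ^ 2 / r ^ 2 := by
  choose! w hw using hball
  set v := volume.real (Metric.ball (0:E2) 1) with hv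
  have hvpos : 0 < v := ENNReal.toReal_pos (Metric.measure_ball_pos _ _ one_pos).ne' measure_ball_lt_top.ne
  have hvol : ∀ (x : E2) (s : ℝ), 0 ≤ s → volume.real (Metric.ball x s) = s ^ 2 * v := by
    intro x s hs
    rw [hv, measureReal_def, measureReal_def, Measure.addHaar_ball (volume : Measure E2) x hs,
      ENNReal.toReal_mul, ENNReal.toReal_ofReal (by positivity)]
    simp
  have hsub : (⋃ P ∈ G, Metric.ball (w P) r) ⊆ Metric.ball 0 (R + D) := by
    intro y hy
    simp only [mem_iUnion] at hy
    obtain ⟨P, hP, hy⟩ := hy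
    obtain ⟨hPT, z, hzP, hz⟩ := hG P hP
    have h1 := hdiam P hPT y (hw P hPT hy) z hzP
    rw [Metric.mem_ball] at hz ⊢
    linarith [dist_triangle y z 0]
  have h1 : volume.real (⋃ P ∈ G, Metric.ball (w P) r) ≤ volume.real (Metric.ball (0:E2) (R + D)) :=
    measureReal_mono hsub measure_ball_lt_top.ne
  rw [measureReal_biUnion_finset] at h1
  · rw [Finset.sum_congr rfl fun P _ => hvol (w P) r hr.le, hvol _ _ (by linarith), Finset.sum_const,
      nsmul_eq_mul] at h1
    rw [le_div_iff₀ (by positivity)]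
    nlinarith
  · intro P hP Q hQ hPQ
    have := hT.2.2.2 (hG P hP).1 (hG Q hQ).1 hPQ
    exact this.mono (interior_maximal (hw P (hG P hP).1) Metric.isOpen_ball)
      (interior_maximal (hw Q (hG Q hQ).1) Metric.isOpen_ball)
  · intro P _; exact measurableSet_ball

lemma tiles_fin {T : Set (Set E2)} (hT : IsTiling T) {D r : ℝ} (hD : 0 < D) (hr : 0 < r)
    (hdiam : ∀ P ∈ T, ∀ y ∈ P, ∀ z ∈ P, dist y z ≤ D)
    (hball : ∀ P ∈ T, ∃ w, Metric.ball w r ⊆ P) {R : ℝ} (hR : 0 ≤ R) :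
    {P | P ∈ T ∧ (P ∩ Metric.ball 0 R).Nonempty}.Finite := by
  by_contra hinf
  obtain ⟨m, hm⟩ := exists_nat_gt ((R + D) ^ 2 / r ^ 2)
  obtain ⟨G, hG, hGc⟩ := Set.Infinite.exists_subset_card_eq hinf m
  have := tiles_count hT hD hr hdiam hball hR G (fun P hP => hG hP)
  rw [hGc] at this
  linarith

end counting

/-- uniform bounds on the tiles -/
lemma uniform_bounds {T : Set (Set E2)} (hT : IsTiling T) (hmc : MonocoronalC T) {x₀ : E2}
    (hx₀ : IsVertex T x₀) (hF : {P | P ∈ T ∧ x₀ ∈ P}.Finite) :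
    ∃ D r : ℝ, 0 < D ∧ 0 < r ∧ (∀ P ∈ T, ∀ y ∈ P, ∀ z ∈ P, dist y z ≤ D) ∧
      (∀ P ∈ T, ∃ w, Metric.ball w r ⊆ P) := by
  have hcong : ∀ Q ∈ T, ∃ P ∈ hF.toFinset, ∃ f : E2 ≃ᵃⁱ[ℝ] E2, Q = f '' P := by
    intro Q hQ
    have hp := hT.2.1 Q hQ
    obtain ⟨z, hz⟩ := hp.2.2.1
    obtain ⟨y, hy⟩ := hp.1.extremePoints_nonempty ⟨z, interior_subset hz⟩
    obtain ⟨f, hf, him⟩ := hmc x₀ y hx₀ ⟨Q, hQ, hy⟩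
    have : Q ∈ {P | P ∈ T ∧ y ∈ P} := ⟨hQ, extremePoints_subset hy⟩
    rw [← him] at this
    obtain ⟨P, hP, rfl⟩ := this
    exact ⟨P, by simpa using hP, f, rfl⟩
  have hr : ∃ r : ℝ, 0 < r ∧ ∀ P ∈ hF.toFinset, ∃ w, Metric.ball w r ⊆ P := by
    have : ∀ᶠ r in nhdsWithin (0:ℝ) (Ioi 0), ∀ P ∈ hF.toFinset, ∃ w, Metric.ball w r ⊆ P := by
      rw [Filter.eventually_all_finset]
      intro P hP
      have hPT : P ∈ T := by simp at hP; exact hP.1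
      obtain ⟨z, hz⟩ := (hT.2.1 P hPT).2.2.1
      obtain ⟨ε, hε, hb⟩ := Metric.isOpen_iff.1 isOpen_interior z hz
      filter_upwards [Ioo_mem_nhdsGT hε] with r hr
      exact ⟨z, (Metric.ball_subset_ball hr.2.le).trans (hb.trans interior_subset)⟩
    obtain ⟨r, h1, h2⟩ := (this.and self_mem_nhdsWithin).exists
    exact ⟨r, h2, h1⟩
  obtain ⟨r, hr0, hr⟩ := hr
  refine ⟨∑ P ∈ hF.toFinset, Metric.diam P + 1, r, ?_, hr0, ?_, ?_⟩
  · have := Finset.sum_nonneg (s := hF.toFinset) (f := fun P => Metric.diam P)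
      fun P _ => Metric.diam_nonneg
    linarith
  · intro Q hQ
    obtain ⟨P, hP, f, rfl⟩ := hcong Q hQ
    rintro _ ⟨y, hy, rfl⟩ _ ⟨z, hz, rfl⟩
    rw [f.dist_map]
    have hPT : P ∈ T := by simp at hP; exact hP.1
    have h1 := Metric.dist_le_diam_of_mem (hT.2.1 P hPT).1.isBounded hy hz
    have h2 := Finset.single_le_sum (f := fun P => Metric.diam P)
      (fun P _ => Metric.diam_nonneg) hP
    linarith
  · intro Q hQ
    obtain ⟨P, hP, f, rfl⟩ := hcong Q hQ
    obtain ⟨w, hw⟩ := hr P hP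
    refine ⟨f w, ?_⟩
    intro y hy
    refine ⟨f.symm y, hw ?_, by simp⟩
    rw [Metric.mem_ball] at hy ⊢
    rw [← f.dist_map]
    simpa using hy

/-- In a face-to-face monocoronal tiling in which every vertex is incident to
exactly `n` polygons with `a 0, …, a (n-1)` many edges respectively, one has
`∑ 1 / a i = n / 2 - 1`. -/
theorem monocoronal_faceToFace_angle_equation (T : Set (Set E2)) (hT : IsTiling T)
    (hf2f : FaceToFace T) (hmc : MonocoronalC T)
    (hext : ∀ x : E2, IsVertex T x → ∀ P ∈ T, x ∈ P → x ∈ Set.extremePoints ℝ P)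
    (n : ℕ) (hn : 1 ≤ n) (a : Fin n → ℕ) (ha : ∀ i, 3 ≤ a i)
    (hcor : ∀ x : E2, IsVertex T x →
      ∃ hfin : {P | P ∈ T ∧ x ∈ P}.Finite,
        hfin.toFinset.card = n ∧
        hfin.toFinset.val.map (fun P => (Set.extremePoints ℝ P).ncard) =
          (Finset.univ.val : Multiset (Fin n)).map fun i => a i) :
    ∑ i : Fin n, (1 : ℝ) / (a i : ℝ) = (n : ℝ) / 2 - 1 := by
  classical
  have hpol := hT.2.1
  have hextne : ∀ P ∈ T, (extremePoints ℝ P).Nonempty := by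
    intro P hP
    obtain ⟨z, hz⟩ := (hpol P hP).2.2.1
    exact (hpol P hP).1.extremePoints_nonempty ⟨z, interior_subset hz⟩
  obtain ⟨x₀, hx₀⟩ : ∃ x, IsVertex T x := by
    have : (0 : E2) ∈ ⋃₀ T := by rw [hT.2.2.1]; trivial
    obtain ⟨P, hP, _⟩ := this
    obtain ⟨x, hx⟩ := hextne P hP
    exact ⟨x, P, hP, hx⟩
  obtain ⟨D, r, hD, hr, hdiam, hball⟩ := uniform_bounds hT hmc hx₀ (hcor x₀ hx₀).1
  -- incidence data
  have hNfin : ∀ x, {P | P ∈ T ∧ x ∈ extremePoints ℝ P}.Finite := by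
    intro x
    by_cases hx : IsVertex T x
    · exact (hcor x hx).1.subset fun P hP => ⟨hP.1, extremePoints_subset hP.2⟩
    · convert Set.finite_empty
      ext P; simp only [mem_ofPred_eq, mem_empty_iff_false, iff_false]
      rintro ⟨h1, h2⟩; exact hx ⟨P, h1, h2⟩
  set N : E2 → Finset (Set E2) := fun x => (hNfin x).toFinset with hN
  have memN : ∀ x P, P ∈ N x ↔ P ∈ T ∧ x ∈ extremePoints ℝ P := by
    intro x P; simp [hN]
  have memN' : ∀ x, IsVertex T x → ∀ P, P ∈ N x ↔ P ∈ T ∧ x ∈ P := by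
    intro x hx P
    rw [memN]
    exact ⟨fun h => ⟨h.1, extremePoints_subset h.2⟩, fun h => ⟨h.1, hext x hx P h.1 h.2⟩⟩
  have hNcor : ∀ x, IsVertex T x → (N x).card = n ∧
      (N x).val.map (fun P => (Set.extremePoints ℝ P).ncard) =
          (Finset.univ.val : Multiset (Fin n)).map fun i => a i := by
    intro x hx
    obtain ⟨hfin, h1, h2⟩ := hcor x hx
    have : N x = hfin.toFinset := by
      ext P; rw [memN' x hx]; simp
    rw [this]; exact ⟨h1, h2⟩
  set M : Set E2 → Finset E2 := fun P =>
    if h : (extremePoints ℝ P).Finite then h.toFinset else ∅ with hM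
  have hMeq : ∀ P (hP : P ∈ T), M P = (hpol P hP).2.2.2.toFinset := by
    intro P hP; simp only [hM]; rw [dif_pos (hpol P hP).2.2.2]
  have memM : ∀ P ∈ T, ∀ x, x ∈ M P ↔ x ∈ extremePoints ℝ P := by
    intro P hP x; rw [hMeq P hP]; simp
  have cardM : ∀ P ∈ T, (M P).card = (extremePoints ℝ P).ncard := by
    intro P hP; rw [hMeq P hP, Set.ncard_eq_toFinset_card _ (hpol P hP).2.2.2]
  have hA : ∀ P ∈ T, (M P).card ≤ ∑ i, a i := by
    intro P hP
    obtain ⟨x, hx⟩ := hextne P hP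
    have h2 := (hNcor x ⟨P, hP, hx⟩).2
    have h3 : (extremePoints ℝ P).ncard ∈
        (N x).val.map (fun P => (Set.extremePoints ℝ P).ncard) :=
      Multiset.mem_map_of_mem _ ((memN x P).2 ⟨hP, hx⟩)
    rw [h2, Multiset.mem_map] at h3
    obtain ⟨i, _, hi⟩ := h3
    rw [cardM P hP, ← hi]
    exact Finset.single_le_sum (f := a) (fun _ _ => Nat.zero_le _) (Finset.mem_univ i)
  -- exhaustion
  set ρ : ℝ := ‖x₀‖ + 1 with hρ
  have hρ0 : 0 < ρ := by positivity
  have hRk : ∀ k : ℕ, 0 ≤ ρ + k * D := fun k => by positivity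
  have htf := fun k : ℕ => tiles_fin hT hD hr hdiam hball (hRk k)
  have hsub : ∀ k : ℕ, {x | IsVertex T x ∧ x ∈ Metric.ball 0 (ρ + k * D)} ⊆
      ((htf k).toFinset.biUnion M : Finset E2) := by
    rintro k x ⟨⟨P, hP, hx⟩, hxb⟩
    simp only [Finset.coe_biUnion, mem_iUnion, Finset.mem_coe]
    exact ⟨P, by simpa using ⟨hP, x, extremePoints_subset hx, by simpa using hxb⟩,
      (memM P hP x).2 hx⟩
  have hSfin : ∀ k : ℕ, {x | IsVertex T x ∧ x ∈ Metric.ball 0 (ρ + k * D)}.Finite :=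
    fun k => (Finset.finite_toSet _).subset (hsub k)
  set S : ℕ → Finset E2 := fun k => (hSfin k).toFinset with hS
  have memS : ∀ k x, x ∈ S k ↔ IsVertex T x ∧ x ∈ Metric.ball 0 (ρ + k * D) := by
    intro k x; simp only [hS, Finite.mem_toFinset, mem_ofPred_eq]
  set U := nm univ with hU
  have hU0 : 0 < U := nm_univ_pos
  have main : (n : ℝ) * (U / 2) - U - U * ∑ i : Fin n, (1 : ℝ) / (a i : ℝ) = 0 := by
    refine growth S ?_ N M (fun P x => nm (Nr P x) - U / (extremePoints ℝ P).ncard) n _ U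
      ((∑ i, a i : ℕ) * ((ρ + D) ^ 2 / r ^ 2)) hU0 ?_ hn ?_ ?_ ?_ ?_ ?_ ?_ ?_ ?_
    · intro k x hx
      rw [memS] at hx ⊢
      refine ⟨hx.1, Metric.ball_subset_ball ?_ hx.2⟩
      push_cast; linarith
    · intro k x hx
      exact (hNcor x ((memS k x).1 hx).1).1.le
    · intro k x hx P hP y hy
      have hPT := ((memN x P).1 hP).1
      exact (memN y P).2 ⟨hPT, (memM P hPT y).1 hy⟩
    · intro k x hx P hP y hy
      have h := (memN y P).1 hy
      exact (memM P h.1 y).2 h.2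
    · intro k x hx P hP
      have h1 := nm_nonneg (Nr P x)
      have h2 := nm_le (Nr P x)
      have h3 : 0 ≤ U / (extremePoints ℝ P).ncard := by positivity
      have h4 : U / (extremePoints ℝ P).ncard ≤ U := by
        rcases Nat.eq_zero_or_pos (extremePoints ℝ P).ncard with h | h
        · rw [h]; simp [hU0.le]
        · exact div_le_self hU0.le (by exact_mod_cast h)
      rw [abs_le]; constructor <;> linarith
    · intro k x hx P hP
      have hPT := ((memN x P).1 hP).1
      rw [Finset.sum_sub_distrib, Finset.sum_const, nsmul_eq_mul, cardM P hPT, hMeq P hPT,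
        poly_ext_sum (hpol P hPT)]
      have : 0 < (extremePoints ℝ P).ncard :=
        (Set.ncard_pos (hpol P hPT).2.2.2).2 (hextne P hPT)
      have : (0:ℝ) < (extremePoints ℝ P).ncard := by exact_mod_cast this
      field_simp
      rw [← hU]; ring
    · intro k x hx
      have hxv := ((memS k x).1 hx).1
      obtain ⟨hc1, hc2⟩ := hNcor x hxv
      have hloc : {P | P ∈ T ∧ (P ∩ Metric.ball x 1).Nonempty}.Finite := by
        refine (tiles_fin hT hD hr hdiam hball (R := ‖x‖ + 1) (by positivity)).subset ?_
        rintro P ⟨hP, z, hz, hzb⟩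
        refine ⟨hP, z, hz, ?_⟩
        rw [Metric.mem_ball] at hzb ⊢
        have := dist_triangle z x 0
        rw [dist_zero_right x] at this
        linarith
      have hfa := full_angle hT hloc (hext x hxv) (N x) (memN' x hxv)
      have hNr : ∑ P ∈ N x, nm (Nr P x) = n * (U / 2) - U := by
        have : ∀ P ∈ N x, nm (Nr P x) = U / 2 - nm (Cn P x) := by
          intro P hP
          have h := (memN x P).1 hP
          have := (poly_cones (hpol P h.1) h.2).2
          linarith
        rw [Finset.sum_congr rfl this, Finset.sum_sub_distrib, hfa, Finset.sum_const, hc1,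
          nsmul_eq_mul]
      have hrec : ∑ P ∈ N x, U / ((extremePoints ℝ P).ncard : ℝ) =
          U * ∑ i : Fin n, (1 : ℝ) / (a i : ℝ) := by
        have := congrArg (fun m : Multiset ℕ => (m.map (fun j : ℕ => (1:ℝ) / (j:ℝ))).sum) hc2
        simp only [Multiset.map_map] at this
        rw [Finset.sum_eq_multiset_sum Finset.univ, ← Function.comp_def (fun j : ℕ => (1:ℝ) / (j:ℝ)) a, ← this,
          Function.comp_def, ← Finset.sum_eq_multiset_sum, Finset.mul_sum]
        simp [div_eq_mul_inv]
      rw [Finset.sum_sub_distrib, hNr, hrec]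
    · intro k x hx P hP y hy
      have hP' := (memN x P).1 hP
      have hy' := (memM P hP'.1 y).1 hy
      have hx' := (memS k x).1 hx
      rw [memS]
      refine ⟨⟨P, hP'.1, hy'⟩, ?_⟩
      have h1 := hdiam P hP'.1 y (extremePoints_subset hy') x (extremePoints_subset hP'.2)
      have h2 := hx'.2
      rw [Metric.mem_ball] at h2 ⊢
      have := dist_triangle y x 0
      push_cast
      linarith
    · refine ⟨x₀, (memS 0 x₀).2 ⟨hx₀, ?_⟩⟩
      simp [hρ]
    · intro k
      have h1 : (S k).card ≤ ((htf k).toFinset.biUnion M).card := by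
        apply Finset.card_le_card
        intro x hx
        have := hsub k ((memS k x).1 hx)
        simpa only [Finset.mem_coe] using this
      have h2 : ((htf k).toFinset.biUnion M).card ≤ (htf k).toFinset.card * ∑ i, a i := by
        apply Finset.card_biUnion_le_card_mul
        intro P hP
        exact hA P ((htf k).mem_toFinset.1 hP).1
      have h3 := tiles_count hT hD hr hdiam hball (hRk k) (htf k).toFinset
        (fun P hP => (htf k).mem_toFinset.1 hP)
      have h4 : (ρ + k * D + D) ^ 2 / r ^ 2 ≤ (ρ + D) ^ 2 / r ^ 2 * ((k:ℝ) + 1) ^ 2 := by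
        rw [div_mul_eq_mul_div, ← mul_pow]
        have : ρ + k * D + D ≤ (ρ + D) * ((k:ℝ) + 1) := by
          have : 0 ≤ ρ * (k:ℝ) := by positivity
          linarith
        gcongr
      have h5 : ((S k).card : ℝ) ≤ ((htf k).toFinset.card : ℝ) * (∑ i, a i : ℕ) := by
        exact_mod_cast h1.trans h2
      refine h5.trans ?_
      have h6 := h3.trans h4
      have h7 : (0:ℝ) ≤ (∑ i, a i : ℕ) := Nat.cast_nonneg _
      have := mul_le_mul_of_nonneg_right h6 h7
      linarith
  have h8 : U * ((n:ℝ) / 2 - 1 - ∑ i : Fin n, (1 : ℝ) / (a i : ℝ)) = 0 := by linarith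
  rcases mul_eq_zero.1 h8 with h | h
  · exact absurd h hU0.ne'
  · linarith
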